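/- (Cold Temperature Scalings.) Let f : ℝ → (0,∞) with h := log f four times continuously differentiable, h'(0) = 0, h''(0) < 0, and |h''''(z)| ≤ M for all z ∈ ℝ and some M > 0. Assume f^β is integrable for all β ≥ 1. For β ≥ 1 let g_β be the probability density on ℝ proportional to y ↦ f(y/√(−β h''(0)))^β, with expectation E_{g_β} and variance Var_{g_β}. Assume (a) sup_{β ≥ 1} E_{g_β}[Y^8] < ∞, and (b) there exists γ > 0 with |Var_{g_β}(Y²) − 2| = O(β^{−γ}) as β → ∞. With I(β) := Var_β[log f] and R(β) := E_β[X² h''(X) − X h'(X)] under the density f^β/Z_β, one has 1/(2β²) − I(β) + (1/(4β)) R(β) = O(β^{−k}) as β → ∞, where k = min(2+γ, 3) > 2 if h'''(0) = 0 (in particular if f is symmetric about its mode 0), and k = min(2+γ, 5/2) > 2 otherwise. -/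

import Mathlib

open MeasureTheory Filter Asymptotics

/-- `h = log f`. -/
noncomputable def hlog (f : ℝ → ℝ) : ℝ → ℝ := fun x => Real.log (f x)

/-- Tempered expectation `E_β[φ] = Z_β⁻¹ ∫ φ(x) f(x)^β dx`. -/
noncomputable def Eb (f : ℝ → ℝ) (β : ℝ) (φ : ℝ → ℝ) : ℝ :=
  (∫ x, φ x * f x ^ β) / (∫ x, f x ^ β)

/-- Tempered variance `Var_β[φ] = E_β[φ²] − (E_β[φ])²`. -/
noncomputable def Varb (f : ℝ → ℝ) (β : ℝ) (φ : ℝ → ℝ) : ℝ :=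
  Eb f β (fun x => φ x ^ 2) - (Eb f β φ) ^ 2

/-- Expectation under the rescaled tempered density `g_β ∝ y ↦ f(y/√(−β h''(0)))^β`. -/
noncomputable def Egb (f : ℝ → ℝ) (β : ℝ) (φ : ℝ → ℝ) : ℝ :=
  (∫ y, φ y * f (y / Real.sqrt (-β * deriv (deriv (hlog f)) 0)) ^ β) /
    (∫ y, f (y / Real.sqrt (-β * deriv (deriv (hlog f)) 0)) ^ β)

/-- Variance under the rescaled tempered density `g_β`. -/
noncomputable def Vargb (f : ℝ → ℝ) (β : ℝ) (φ : ℝ → ℝ) : ℝ :=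
  Egb f β (fun y => φ y ^ 2) - (Egb f β φ) ^ 2


theorem rpow_eq_exp_hlog {f : ℝ → ℝ} (hf : ∀ x, 0 < f x) (β x : ℝ) :
    f x ^ β = Real.exp (hlog f x * β) :=
  Real.rpow_def_of_pos (hf x) β

theorem Eb_eq_integral_tilted {f : ℝ → ℝ} (hf : ∀ x, 0 < f x) (β : ℝ) (φ : ℝ → ℝ) :
    Eb f β φ = ∫ x, φ x ∂(volume.tilted fun x => hlog f x * β) := by
  rw [integral_tilted, Eb, ← integral_div]
  simp only [rpow_eq_exp_hlog hf, smul_eq_mul]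
  congr 1
  ext x
  ring

theorem Egb_eq_Eb {f : ℝ → ℝ} {β s : ℝ} (hs : s = √(-β * deriv (deriv (hlog f)) 0)) (hs0 : 0 < s)
    (φ : ℝ → ℝ) : Egb f β φ = Eb f β (fun x => φ (s * x)) := by
  have h1 := Measure.integral_comp_div (fun x => φ (s * x) * f x ^ β) s
  have h2 := Measure.integral_comp_div (fun x => f x ^ β) s
  have h3 : ∀ y, s * (y / s) = y := fun y => by field_simp
  simp only [h3, smul_eq_mul] at h1 h2
  rw [Egb, Eb, ← hs, h1, h2, mul_div_mul_left _ _ (abs_pos.2 hs0.ne').ne']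

/-- Adding a perturbation of size `δ` to a function of size `α` changes its variance by
`O(α δ + δ²)`. -/
theorem abs_variance_add_sub_le {μ : Measure ℝ} [IsProbabilityMeasure μ] {A B W : ℝ → ℝ}
    (hA : AEStronglyMeasurable A μ) (hB : AEStronglyMeasurable B μ) (hW : ∀ x, 1 ≤ W x)
    (hW2 : Integrable (fun x => W x ^ 2) μ) {K α δ : ℝ} (hK : ∫ x, W x ^ 2 ∂μ ≤ K)
    (hα : 0 ≤ α) (hδ : 0 ≤ δ) (hAW : ∀ x, |A x| ≤ α * W x) (hBW : ∀ x, |B x| ≤ δ * W x) (c : ℝ) :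
    |((∫ x, (c + A x + B x) ^ 2 ∂μ) - (∫ x, (c + A x + B x) ∂μ) ^ 2)
      - ((∫ x, A x ^ 2 ∂μ) - (∫ x, A x ∂μ) ^ 2)| ≤ 4 * (α * δ + δ ^ 2) * K ^ 2 := by
  have hWW : ∀ x, W x ≤ W x ^ 2 := fun x => by nlinarith [hW x]
  have dom : ∀ (F : ℝ → ℝ) (k : ℝ), AEStronglyMeasurable F μ → (∀ x, |F x| ≤ k * W x ^ 2) →
      0 ≤ k → Integrable F μ ∧ |∫ x, F x ∂μ| ≤ k * K := by
    intro F k hF hk hk0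
    refine ⟨(hW2.const_mul k).mono' hF (.of_forall hk), ?_⟩
    calc |∫ x, F x ∂μ| ≤ ∫ x, k * W x ^ 2 ∂μ :=
          norm_integral_le_of_norm_le (f := F) (hW2.const_mul k) (.of_forall hk)
      _ = k * ∫ x, W x ^ 2 ∂μ := integral_const_mul _ _
      _ ≤ k * K := by gcongr
  have hK1 : 1 ≤ K := by
    refine le_trans ?_ hK
    calc (1 : ℝ) = ∫ _, (1 : ℝ) ∂μ := by simp
      _ ≤ _ := integral_mono (integrable_const _) hW2 fun x => (hW x).trans (hWW x)
  obtain ⟨iA, bA⟩ := dom A α hA (fun x => (hAW x).trans (by gcongr; exact hWW x)) hα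
  obtain ⟨iB, bB⟩ := dom B δ hB (fun x => (hBW x).trans (by gcongr; exact hWW x)) hδ
  have prod : ∀ {F G : ℝ → ℝ} {k l : ℝ}, (∀ x, |F x| ≤ k * W x) → (∀ x, |G x| ≤ l * W x) →
      ∀ x, |F x * G x| ≤ k * l * W x ^ 2 := by
    intro F G k l hF hG x
    rw [abs_mul]
    calc |F x| * |G x| ≤ (k * W x) * (l * W x) :=
          mul_le_mul (hF x) (hG x) (abs_nonneg _) ((abs_nonneg _).trans (hF x))
      _ = _ := by ring
  obtain ⟨iAA, -⟩ := dom (fun x => A x * A x) (α * α) (hA.mul hA) (prod hAW hAW) (by positivity)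
  obtain ⟨iAB, bAB⟩ := dom (fun x => A x * B x) (α * δ) (hA.mul hB) (prod hAW hBW) (by positivity)
  obtain ⟨iBB, bBB⟩ := dom (fun x => B x * B x) (δ * δ) (hB.mul hB) (prod hBW hBW) (by positivity)
  have e1 : ∫ x, (c + A x + B x) ∂μ = c + ∫ x, A x ∂μ + ∫ x, B x ∂μ := by
    rw [integral_add (by fun_prop) iB, integral_add (by fun_prop) iA]
    simp
  have e2 : ∫ x, (c + A x + B x) ^ 2 ∂μ = c ^ 2 + 2 * c * ∫ x, A x ∂μ + 2 * c * ∫ x, B x ∂μ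
      + ∫ x, A x * A x ∂μ + 2 * ∫ x, A x * B x ∂μ + ∫ x, B x * B x ∂μ := by
    have : ∀ x, (c + A x + B x) ^ 2 = c ^ 2 + 2 * c * A x + 2 * c * B x + A x * A x
        + 2 * (A x * B x) + B x * B x := fun x => by ring
    simp only [this]
    rw [integral_add (by fun_prop) iBB, integral_add (by fun_prop) (by fun_prop),
      integral_add (by fun_prop) iAA, integral_add (by fun_prop) (by fun_prop),
      integral_add (by fun_prop) (by fun_prop)]
    simp [integral_const_mul]
  have e3 : ∫ x, A x ^ 2 ∂μ = ∫ x, A x * A x ∂μ := by simp only [sq]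
  rw [e1, e2, e3]
  set a := ∫ x, A x ∂μ
  set b := ∫ x, B x ∂μ
  have hab : |a * b| ≤ α * δ * K ^ 2 := by
    rw [abs_mul]
    calc |a| * |b| ≤ (α * K) * (δ * K) := mul_le_mul bA bB (abs_nonneg _) (by positivity)
      _ = _ := by ring
  have hbb : |b * b| ≤ δ ^ 2 * K ^ 2 := by
    rw [abs_mul]
    calc |b| * |b| ≤ (δ * K) * (δ * K) := mul_le_mul bB bB (abs_nonneg _) (by positivity)
      _ = _ := by ring
  have hKK : K ≤ K ^ 2 := by nlinarith
  have h1 : α * δ * K ≤ α * δ * K ^ 2 := by gcongr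
  have h2 : δ * δ * K ≤ δ ^ 2 * K ^ 2 := by rw [← sq]; gcongr
  have h3 : 0 ≤ δ ^ 2 * K ^ 2 := by positivity
  rw [abs_le] at *
  constructor <;> nlinarith

/-- A function vanishing at `0` whose derivative is `O(|x|ⁿ)` is `O(|x|ⁿ⁺¹)`. -/
theorem abs_le_pow_succ_of_abs_deriv_le {F F' : ℝ → ℝ} {M : ℝ} (hM : 0 ≤ M) {n : ℕ}
    (hF : ∀ x, HasDerivAt F (F' x) x) (h0 : F 0 = 0) (hb : ∀ x, |F' x| ≤ M * |x| ^ n) (x : ℝ) :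
    |F x| ≤ M * |x| ^ (n + 1) := by
  have := (convex_uIcc (0 : ℝ) x).norm_image_sub_le_of_norm_hasDerivWithin_le
    (f := F) (f' := F') (C := M * |x| ^ n) (fun t _ => (hF t).hasDerivWithinAt)
    (fun t ht => (hb t).trans ?_) Set.left_mem_uIcc Set.right_mem_uIcc
  · simpa [h0, pow_succ, mul_assoc] using this
  · have : |t| ≤ |x| := by simpa using Set.abs_sub_left_of_mem_uIcc ht
    gcongr

/-- Polynomial growth of `h'` turns integrability of `x⁴ exp (β h)` into a pointwise decay. -/
theorem exists_exp_le_div_abs {h h' : ℝ → ℝ} {D β : ℝ} (hβ : 0 < β) (hD : 0 ≤ D)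
    (hh : ∀ x, HasDerivAt h (h' x) x) (hb : ∀ x, 1 / 2 ≤ |x| → |h' x| ≤ D * |x| ^ 3)
    (hi : Integrable fun x => x ^ 4 * Real.exp (h x * β)) :
    ∃ K : ℝ, 0 < K ∧ ∀ x, 1 ≤ |x| → Real.exp (h x * β) ≤ K / |x| := by
  set J := ∫ x, x ^ 4 * Real.exp (h x * β)
  have hJ0 : 0 ≤ J := integral_nonneg fun x => by positivity
  refine ⟨16 * Real.exp (4 * D * β) * J + 1, by positivity, fun x hx => ?_⟩
  set r := 1 / (2 * |x| ^ 3) with hr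
  have hx0 : 0 < |x| := by linarith
  have hr0 : 0 < r := by positivity
  have hr1 : r ≤ 1 / 2 := by
    rw [hr, div_le_div_iff₀ (by positivity) (by norm_num)]
    have := one_le_pow₀ hx (n := 3)
    linarith
  have hwin : ∀ y ∈ Metric.closedBall x r, |x| / 2 ≤ |y| ∧ |y| ≤ 2 * |x| := by
    intro y hy
    rw [Metric.mem_closedBall, Real.dist_eq] at hy
    have h1 := abs_sub_abs_le_abs_sub x y
    have h2 := abs_sub_abs_le_abs_sub y x
    rw [abs_sub_comm x y] at h1
    constructor <;> linarith
  have hlow : ∀ y ∈ Metric.closedBall x r,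
      |x| ^ 4 / 16 * Real.exp (h x * β - 4 * D * β) ≤ y ^ 4 * Real.exp (h y * β) := by
    intro y hy
    have hd := (convex_closedBall x r).norm_image_sub_le_of_norm_hasDerivWithin_le
      (f := h) (f' := h') (C := D * (2 * |x|) ^ 3) (fun t _ => (hh t).hasDerivWithinAt)
      (fun t ht => (hb t (by linarith [hwin t ht])).trans
        (by gcongr; exact (hwin t ht).2)) (Metric.mem_closedBall_self hr0.le) hy
    rw [Metric.mem_closedBall, Real.dist_eq] at hy
    have h4 : h x - h y ≤ 4 * D := by
      calc h x - h y ≤ |h y - h x| := by rw [abs_sub_comm]; exact le_abs_self _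
        _ ≤ D * (2 * |x|) ^ 3 * |y - x| := hd
        _ ≤ D * (2 * |x|) ^ 3 * r := by gcongr
        _ = 4 * D := by rw [hr]; field_simp; norm_num
    have hy4 : |x| ^ 4 / 16 ≤ y ^ 4 := by
      have := pow_le_pow_left₀ (by positivity) (hwin y hy).1 4
      rw [div_pow, Even.pow_abs (by decide) y] at this
      linarith
    have h5 : h x * β - 4 * D * β ≤ h y * β := by nlinarith
    gcongr
  have hint : |x| ^ 4 / 16 * Real.exp (h x * β - 4 * D * β) * (2 * r) ≤ J := by
    calc _ = ∫ _ in Metric.closedBall x r, |x| ^ 4 / 16 * Real.exp (h x * β - 4 * D * β) := by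
          rw [setIntegral_const, Measure.real, Real.volume_closedBall,
            ENNReal.toReal_ofReal (by positivity), smul_eq_mul, mul_comm]
      _ ≤ ∫ y in Metric.closedBall x r, y ^ 4 * Real.exp (h y * β) :=
          setIntegral_mono_on (integrableOn_const measure_closedBall_lt_top.ne) hi.integrableOn
            Metric.isClosed_closedBall.measurableSet hlow
      _ ≤ J := setIntegral_le_integral hi (.of_forall fun y => by positivity)
  rw [Real.exp_sub, hr] at hint
  have hE := Real.exp_pos (4 * D * β)
  rw [le_div_iff₀ hx0]
  have : |x| ^ 4 / 16 * (Real.exp (h x * β) / Real.exp (4 * D * β)) * (2 * (1 / (2 * |x| ^ 3)))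
      = Real.exp (h x * β) * |x| / (16 * Real.exp (4 * D * β)) := by
    field_simp
  rw [this, div_le_iff₀ (by positivity)] at hint
  linarith

/-- Under the same growth condition all eighth moments are finite at low temperatures. -/
theorem integrable_pow_eight_mul_exp {h h' : ℝ → ℝ} {D β₀ : ℝ} (hβ₀ : 1 ≤ β₀) (hD : 0 ≤ D)
    (hh : ∀ x, HasDerivAt h (h' x) x) (hb : ∀ x, 1 / 2 ≤ |x| → |h' x| ≤ D * |x| ^ 3)
    (hint : ∀ β, 1 ≤ β → Integrable fun x => Real.exp (h x * β))
    (hi : Integrable fun x => x ^ 4 * Real.exp (h x * β₀)) {β : ℝ} (hβ : 9 * β₀ ≤ β) :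
    Integrable fun x => x ^ 8 * Real.exp (h x * β) := by
  have hp : 0 < β₀ := by linarith
  obtain ⟨K, hK, hle⟩ := exists_exp_le_div_abs hp hD hh hb hi
  set t := (β - β₀) / β₀ with ht
  have ht8 : 8 ≤ t := by rw [ht, le_div_iff₀ hp]; linarith
  have hc : Continuous h := continuous_iff_continuousAt.2 fun x => (hh x).continuousAt
  refine ((hint β (by linarith)).add ((hint β₀ hβ₀).const_mul (K ^ t))).mono'
    (by fun_prop) (.of_forall fun x => ?_)
  rw [Real.norm_of_nonneg (by positivity), Pi.add_apply]
  rcases le_total |x| 1 with hx | hx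
  · have h8 : x ^ 8 ≤ 1 := by
      rw [← Even.pow_abs (by decide) x]
      exact pow_le_one₀ (abs_nonneg x) hx
    have h1 := Real.exp_pos (h x * β)
    have h2 : 0 ≤ K ^ t * Real.exp (h x * β₀) := by positivity
    nlinarith
  · have hx0 : 0 < |x| := by linarith
    have e : Real.exp (h x * β) = Real.exp (h x * β₀) * Real.exp (h x * β₀) ^ t := by
      rw [← Real.exp_mul, ← Real.exp_add, ht]
      congr 1
      field_simp
      ring
    have h1 : Real.exp (h x * β₀) ^ t ≤ K ^ t / |x| ^ t := by
      rw [← Real.div_rpow hK.le hx0.le]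
      exact Real.rpow_le_rpow (Real.exp_pos _).le (hle x hx) (by linarith)
    have h2 : x ^ 8 ≤ |x| ^ t := by
      rw [← Even.pow_abs (by decide) x, ← Real.rpow_natCast]
      exact Real.rpow_le_rpow_of_exponent_le hx (by exact_mod_cast ht8)
    have h3 : x ^ 8 * Real.exp (h x * β₀) ^ t ≤ K ^ t := by
      calc _ ≤ |x| ^ t * (K ^ t / |x| ^ t) := by gcongr
        _ = K ^ t := by field_simp
    have h4 := Real.exp_pos (h x * β₀)
    have h5 := Real.exp_pos (h x * β)
    rw [e] at h5 ⊢
    nlinarith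

/-- Taylor bounds at a critical point for `h`, `h'` and `h''` when `h''''` is bounded. -/
theorem taylor_bounds_of_abs_deriv_four_le {h : ℝ → ℝ} {M : ℝ} (hs : ContDiff ℝ 4 h)
    (h0 : deriv h 0 = 0) (hM : 0 ≤ M) (hb : ∀ z, |deriv (deriv (deriv (deriv h))) z| ≤ M) (x : ℝ) :
    |deriv (deriv h) x - (deriv (deriv h) 0 + deriv (deriv (deriv h)) 0 * x)| ≤ M * |x| ^ 2 ∧
    |deriv h x - (deriv (deriv h) 0 * x + deriv (deriv (deriv h)) 0 * x ^ 2 / 2)|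
      ≤ M * |x| ^ 3 ∧
    |h x - (h 0 + deriv (deriv h) 0 * x ^ 2 / 2 + deriv (deriv (deriv h)) 0 * x ^ 3 / 6)|
      ≤ M * |x| ^ 4 := by
  have d0 : ∀ x, HasDerivAt h (deriv h x) x := fun x =>
    (hs.differentiable (by norm_num)).differentiableAt.hasDerivAt
  have d1 : ∀ x, HasDerivAt (deriv h) (deriv (deriv h) x) x := fun x =>
    ((hs.iterate_deriv' 3 1).differentiable (by norm_num)).differentiableAt.hasDerivAt
  have d2 : ∀ x, HasDerivAt (deriv (deriv h)) (deriv (deriv (deriv h)) x) x := fun x =>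
    ((hs.iterate_deriv' 2 2).differentiable (by norm_num)).differentiableAt.hasDerivAt
  have d3 : ∀ x, HasDerivAt (deriv (deriv (deriv h))) (deriv (deriv (deriv (deriv h))) x) x :=
    fun x => ((hs.iterate_deriv' 1 3).differentiable (by norm_num)).differentiableAt.hasDerivAt
  set b := deriv (deriv (deriv h)) 0
  set c := deriv (deriv h) 0
  have t3 := abs_le_pow_succ_of_abs_deriv_le (n := 0) hM (fun x => (d3 x).sub_const b)
    (by simp [b]) (by simpa using hb)
  have t2 := abs_le_pow_succ_of_abs_deriv_le hM
    (F := fun x => deriv (deriv h) x - (c + b * x)) (fun x => by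
      exact ((d2 x).sub (((hasDerivAt_id x).const_mul b).const_add c)).congr_deriv (by ring))
    (by simp [c]) t3
  have t1 := abs_le_pow_succ_of_abs_deriv_le hM
    (F := fun x => deriv h x - (c * x + b * x ^ 2 / 2)) (fun x => by
      exact ((d1 x).sub (((hasDerivAt_id x).const_mul c).add
        (((hasDerivAt_pow 2 x).const_mul b).div_const 2))).congr_deriv (by push_cast; ring))
    (by simp [h0]) t2
  have t0 := abs_le_pow_succ_of_abs_deriv_le hM
    (F := fun x => h x - (h 0 + c * x ^ 2 / 2 + b * x ^ 3 / 6)) (fun x => by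
      exact ((d0 x).sub (((((hasDerivAt_pow 2 x).const_mul c).div_const 2).const_add (h 0)).add
        (((hasDerivAt_pow 3 x).const_mul b).div_const 6))).congr_deriv (by push_cast; ring))
    (by simp) t1
  exact ⟨t2 x, t1 x, t0 x⟩

theorem integrable_tilted_hlog_iff {f : ℝ → ℝ} (hf : ∀ x, 0 < f x) {β : ℝ}
    (hi : Integrable fun x => f x ^ β) (φ : ℝ → ℝ) :
    Integrable φ (volume.tilted fun x => hlog f x * β) ↔
      Integrable fun x => φ x * Real.exp (hlog f x * β) := by
  rw [integrable_tilted_iff (by simpa only [rpow_eq_exp_hlog hf] using hi)]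
  simp only [smul_eq_mul, mul_comm]

/-- A nonpositive value of `Vargb` for `y²` is forced when the fourth moment is infinite. -/
theorem integrable_pow_four_mul_exp_of_Vargb_pos {f : ℝ → ℝ} (hf : ∀ x, 0 < f x) {β : ℝ}
    (hβ : 0 < -β * deriv (deriv (hlog f)) 0) (hi : Integrable fun x => f x ^ β)
    (hV : 0 < Vargb f β (fun y => y ^ 2)) :
    Integrable fun x => x ^ 4 * Real.exp (hlog f x * β) := by
  have hs := Real.sqrt_pos.2 hβ
  rw [← integrable_tilted_hlog_iff hf hi]
  by_contra hn
  rw [Vargb, Egb_eq_Eb rfl hs, Egb_eq_Eb rfl hs, Eb_eq_integral_tilted hf, integral_undef] at hV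
  · nlinarith [sq_nonneg (Eb f β fun x => (√(-β * deriv (deriv (hlog f)) 0) * x) ^ 2)]
  · intro hI
    generalize √(-β * deriv (deriv (hlog f)) 0) = s at hs hI
    refine hn ((hI.const_mul (s ^ 4)⁻¹).congr (.of_forall fun x => ?_))
    field_simp

/-- The estimate at a fixed temperature: if the cubic and quartic Taylor remainders are at most
`δ (1 + (s x)⁴)`, the quantity in question differs from `-(Var_g(Y²) - 2) / (4β²)` by
`O(δ/β + δ²)`. -/
theorem abs_quanta_add_le {f : ℝ → ℝ} (hf : ∀ x, 0 < f x) (hsm : ContDiff ℝ 4 (hlog f))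
    (hmode : deriv (hlog f) 0 = 0) {M : ℝ} (hM : 0 ≤ M)
    (hb : ∀ z, |deriv (deriv (deriv (deriv (hlog f)))) z| ≤ M) {β s C δ : ℝ} (hβ : 0 < β)
    (hs0 : 0 < s) (hs : s = √(-β * deriv (deriv (hlog f)) 0))
    (hi : Integrable fun x => f x ^ β)
    (hi8 : Integrable fun x => x ^ 8 * Real.exp (hlog f x * β))
    (hC : Egb f β (fun y => y ^ 8) ≤ C) (hδ : 0 ≤ δ)
    (hP : ∀ x : ℝ, |deriv (deriv (deriv (hlog f))) 0| * |x| ^ 3 + 2 * M * |x| ^ 4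
      ≤ δ * (1 + (s * x) ^ 4)) :
    |1 / (2 * β ^ 2) - Varb f β (hlog f)
      + Eb f β (fun x => x ^ 2 * deriv (deriv (hlog f)) x - x * deriv (hlog f) x) / (4 * β)
      + (Vargb f β (fun y => y ^ 2) - 2) / (4 * β ^ 2)|
    ≤ 4 * (1 / (2 * β) * δ + δ ^ 2) * (2 + 2 * C) ^ 2 + δ * (2 + 2 * C) / (4 * β) := by
  have tay := taylor_bounds_of_abs_deriv_four_le hsm hmode hM hb
  set h := hlog f
  set b := deriv (deriv (deriv h)) 0
  have hs2 : s ^ 2 = -β * deriv (deriv h) 0 := by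
    rw [hs]
    refine Real.sq_sqrt (Real.sqrt_pos.1 (hs ▸ hs0)).le
  have hc0 : Continuous h := hsm.continuous
  have hc1 : Continuous (deriv h) := (hsm.iterate_deriv' 3 1).continuous
  have hc2 : Continuous (deriv (deriv h)) := (hsm.iterate_deriv' 2 2).continuous
  set μ := volume.tilted fun x => h x * β
  have hprob : IsProbabilityMeasure μ :=
    isProbabilityMeasure_tilted (by simpa only [rpow_eq_exp_hlog hf] using hi)
  have i8 : Integrable (fun x => x ^ 8) μ := (integrable_tilted_hlog_iff hf hi _).2 hi8
  set W : ℝ → ℝ := fun x => 1 + (s * x) ^ 4 with hW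
  have hW1 : ∀ x, 1 ≤ W x := fun x => le_add_of_nonneg_right (by positivity)
  have hWle : ∀ x, W x ^ 2 ≤ 2 + 2 * (s * x) ^ 8 := fun x => by
    simp only [hW]; nlinarith [sq_nonneg ((s * x) ^ 4 - 1)]
  have i8s : Integrable (fun x => (s * x) ^ 8) μ := by
    simpa only [mul_pow] using i8.const_mul (s ^ 8)
  have iU : Integrable (fun x => 2 + 2 * (s * x) ^ 8) μ :=
    (integrable_const _).add (i8s.const_mul 2)
  have iW2 : Integrable (fun x => W x ^ 2) μ :=
    iU.mono' (by fun_prop) (.of_forall fun x => by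
      rw [Real.norm_of_nonneg (by positivity)]; exact hWle x)
  have hK : ∫ x, W x ^ 2 ∂μ ≤ 2 + 2 * C := by
    calc _ ≤ ∫ x, (2 + 2 * (s * x) ^ 8) ∂μ := integral_mono iW2 iU hWle
      _ = 2 + 2 * ∫ x, (s * x) ^ 8 ∂μ := by
        rw [integral_add (integrable_const _) (i8s.const_mul 2), integral_const_mul]
        simp
      _ ≤ _ := by
        rw [Egb_eq_Eb hs hs0, Eb_eq_integral_tilted hf] at hC
        gcongr
  set A : ℝ → ℝ := fun x => -(1 / (2 * β)) * (s * x) ^ 2 with hA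
  set B : ℝ → ℝ := fun x => h x - h 0 - A x with hB
  have hAx : ∀ x, A x = deriv (deriv h) 0 * x ^ 2 / 2 := fun x => by
    simp only [hA, mul_pow, hs2]; field_simp
  have hAW : ∀ x, |A x| ≤ 1 / (2 * β) * W x := fun x => by
    simp only [hA, hW]
    rw [abs_mul, abs_neg, abs_of_nonneg (by positivity : 0 ≤ 1 / (2 * β)),
      abs_of_nonneg (by positivity : 0 ≤ (s * x) ^ 2)]
    gcongr
    nlinarith [sq_nonneg ((s * x) ^ 2 - 1), sq_nonneg (s * x)]
  have hBW : ∀ x, |B x| ≤ δ * W x := fun x => by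
    refine le_trans ?_ (hP x)
    obtain ⟨-, -, t⟩ := tay x
    have e : B x = b * x ^ 3 / 6
        + (h x - (h 0 + deriv (deriv h) 0 * x ^ 2 / 2 + b * x ^ 3 / 6)) := by
      simp only [hB, hAx]; ring
    have e3 : |b * x ^ 3 / 6| = |b| * |x| ^ 3 / 6 := by
      rw [abs_div, abs_mul, abs_pow, abs_of_pos (by norm_num : (0 : ℝ) < 6)]
    have := abs_add_le (b * x ^ 3 / 6)
      (h x - (h 0 + deriv (deriv h) 0 * x ^ 2 / 2 + b * x ^ 3 / 6))
    rw [← e, e3] at this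
    have p1 : 0 ≤ |b| * |x| ^ 3 := by positivity
    have p2 : 0 ≤ M * |x| ^ 4 := by positivity
    linarith
  have key := abs_variance_add_sub_le (μ := μ) (A := A) (B := B)
    (by fun_prop) (by fun_prop) hW1 iW2 hK (by positivity) hδ hAW hBW (h 0)
  have hHs : ∀ x, h 0 + A x + B x = h x := fun x => by simp only [hB]; ring
  simp only [hHs] at key
  have eV : (∫ x, A x ^ 2 ∂μ) - (∫ x, A x ∂μ) ^ 2
      = Vargb f β (fun y => y ^ 2) / (4 * β ^ 2) := by
    rw [Vargb, Egb_eq_Eb hs hs0, Egb_eq_Eb hs hs0, Eb_eq_integral_tilted hf,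
      Eb_eq_integral_tilted hf]
    simp only [hA, mul_pow (-(1 / (2 * β)))]
    rw [integral_const_mul, integral_const_mul]
    ring
  have eI : Varb f β h = (∫ x, h x ^ 2 ∂μ) - (∫ x, h x ∂μ) ^ 2 := by
    rw [Varb, Eb_eq_integral_tilted hf, Eb_eq_integral_tilted hf]
  rw [eV, ← eI] at key
  set Q : ℝ → ℝ := fun x => x ^ 2 * deriv (deriv h) x - x * deriv h x with hQ
  have hQW : ∀ x, |Q x| ≤ δ * W x ^ 2 := fun x => by
    have hWW : δ * W x ≤ δ * W x ^ 2 := by gcongr; nlinarith [hW1 x]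
    refine le_trans ?_ ((hP x).trans hWW)
    obtain ⟨t2, t1, -⟩ := tay x
    have e : Q x = b * x ^ 3 / 2
        + (x ^ 2 * (deriv (deriv h) x - (deriv (deriv h) 0 + b * x))
        - x * (deriv h x - (deriv (deriv h) 0 * x + b * x ^ 2 / 2))) := by
      simp only [hQ]; ring
    have e3 : |b * x ^ 3 / 2| = |b| * |x| ^ 3 / 2 := by
      rw [abs_div, abs_mul, abs_pow, abs_of_pos (by norm_num : (0 : ℝ) < 2)]
    have p1 : 0 ≤ |b| * |x| ^ 3 := by positivity
    rw [e]
    refine (abs_add_le _ _).trans ?_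
    have q := abs_sub (x ^ 2 * (deriv (deriv h) x - (deriv (deriv h) 0 + b * x)))
      (x * (deriv h x - (deriv (deriv h) 0 * x + b * x ^ 2 / 2)))
    rw [abs_mul, abs_mul x, abs_pow] at q
    have q2 := mul_le_mul_of_nonneg_left t2 (by positivity : 0 ≤ |x| ^ 2)
    have q1 := mul_le_mul_of_nonneg_left t1 (abs_nonneg x)
    have r : |x| ^ 2 * (M * |x| ^ 2) + |x| * (M * |x| ^ 3) = 2 * M * |x| ^ 4 := by ring
    rw [e3]
    linarith
  have hEQ : |Eb f β Q| ≤ δ * (2 + 2 * C) := by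
    rw [Eb_eq_integral_tilted hf]
    calc |∫ x, Q x ∂μ| ≤ ∫ x, δ * W x ^ 2 ∂μ :=
          norm_integral_le_of_norm_le (f := Q) (iW2.const_mul δ) (.of_forall hQW)
      _ = δ * ∫ x, W x ^ 2 ∂μ := integral_const_mul _ _
      _ ≤ _ := by gcongr
  have e : 1 / (2 * β ^ 2) - Varb f β h + Eb f β Q / (4 * β)
      + (Vargb f β (fun y => y ^ 2) - 2) / (4 * β ^ 2)
      = -(Varb f β h - Vargb f β (fun y => y ^ 2) / (4 * β ^ 2)) + Eb f β Q / (4 * β) := by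
    field_simp; ring
  rw [e]
  refine (abs_add_le _ _).trans (add_le_add (by rwa [abs_neg]) ?_)
  rw [abs_div, abs_of_pos (by positivity : 0 < 4 * β)]
  gcongr

/-- The scaling, for a Taylor remainder of order `p ≥ 3`. -/
theorem quanta_isBigO_of_remainder {f : ℝ → ℝ} (hf : ∀ x, 0 < f x)
    (hsm : ContDiff ℝ 4 (hlog f)) (hmode : deriv (hlog f) 0 = 0)
    (hcurv : deriv (deriv (hlog f)) 0 < 0) {M : ℝ} (hM : 0 ≤ M)
    (hb : ∀ z, |deriv (deriv (deriv (deriv (hlog f)))) z| ≤ M)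
    (hint : ∀ β : ℝ, 1 ≤ β → Integrable (fun x => f x ^ β))
    {C : ℝ} (hmom8 : ∀ β : ℝ, 1 ≤ β → Egb f β (fun y => y ^ 8) ≤ C)
    {γ : ℝ} (hγ : 0 < γ)
    (hvar : (fun β => Vargb f β (fun y => y ^ 2) - 2) =O[atTop] fun β : ℝ => β ^ (-γ))
    {p : ℕ} (hp : 3 ≤ p) {D : ℝ} (hD : 0 ≤ D)
    (hP : ∀ s x : ℝ, 1 ≤ s → |deriv (deriv (deriv (hlog f))) 0| * |x| ^ 3 + 2 * M * |x| ^ 4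
      ≤ D / s ^ p * (1 + (s * x) ^ 4)) :
    (fun β => 1 / (2 * β ^ 2) - Varb f β (hlog f)
      + Eb f β (fun x => x ^ 2 * deriv (deriv (hlog f)) x - x * deriv (hlog f) x) / (4 * β))
      =O[atTop] fun β : ℝ => β ^ (-(min (2 + γ) ((p + 2) / 2))) := by
  set a := -deriv (deriv (hlog f)) 0 with ha
  have ha0 : 0 < a := by linarith
  have hpos : ∀ β, 1 ≤ β → 0 < -β * deriv (deriv (hlog f)) 0 := fun β hβ => by nlinarith
  obtain ⟨β₀, hβ₀, hi4⟩ : ∃ β₀ : ℝ, 1 ≤ β₀ ∧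
      Integrable fun x => x ^ 4 * Real.exp (hlog f x * β₀) := by
    have ht : Tendsto (fun β => Vargb f β (fun y => y ^ 2) - 2) atTop (nhds 0) :=
      hvar.trans_tendsto (tendsto_rpow_neg_atTop hγ)
    obtain ⟨β₀, h1, h2⟩ := ((ht.eventually_const_lt (show (-2 : ℝ) < 0 by norm_num)).and
      (eventually_ge_atTop 1)).exists
    exact ⟨β₀, h2, integrable_pow_four_mul_exp_of_Vargb_pos hf (hpos β₀ h2) (hint β₀ h2)
      (by linarith)⟩
  have hgrow : ∀ x : ℝ, 1 / 2 ≤ |x| → |deriv (hlog f) x| ≤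
      (4 * a + 2 * |deriv (deriv (deriv (hlog f))) 0| + M) * |x| ^ 3 := by
    intro x hx
    obtain ⟨-, t, -⟩ := taylor_bounds_of_abs_deriv_four_le hsm hmode hM hb x
    set b := deriv (deriv (deriv (hlog f))) 0
    have h1 := abs_add_le (deriv (hlog f) x - (deriv (deriv (hlog f)) 0 * x + b * x ^ 2 / 2))
      (deriv (deriv (hlog f)) 0 * x + b * x ^ 2 / 2)
    have h2 := abs_add_le (deriv (deriv (hlog f)) 0 * x) (b * x ^ 2 / 2)
    rw [sub_add_cancel] at h1
    rw [abs_mul, abs_div, abs_mul, abs_pow, abs_of_neg hcurv,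
      abs_of_pos (by norm_num : (0 : ℝ) < 2), ← ha] at h2
    have h3 : |x| ^ 2 ≤ 2 * |x| ^ 3 := by nlinarith [sq_nonneg |x|]
    have h4 : |x| ≤ 4 * |x| ^ 3 := by nlinarith
    have h5 := mul_le_mul_of_nonneg_left h4 ha0.le
    have h6 := mul_le_mul_of_nonneg_left h3 (abs_nonneg b)
    nlinarith [mul_nonneg (abs_nonneg b) (pow_nonneg (abs_nonneg x) 3)]
  have hrem : (fun β => 1 / (2 * β ^ 2) - Varb f β (hlog f)
      + Eb f β (fun x => x ^ 2 * deriv (deriv (hlog f)) x - x * deriv (hlog f) x) / (4 * β)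
      + (Vargb f β (fun y => y ^ 2) - 2) / (4 * β ^ 2))
      =O[atTop] fun β : ℝ => β ^ (-((p + 2) / 2 : ℝ)) := by
    set K := 2 + 2 * C
    refine IsBigO.of_bound
      ((2 * D * K ^ 2 + 4 * D ^ 2 * K ^ 2 / a + D * K / 4) / a ^ (p / 2 : ℝ)) ?_
    filter_upwards [eventually_ge_atTop 1, eventually_ge_atTop (9 * β₀),
      eventually_ge_atTop (1 / a)] with β h1 h9 hβa
    have hβ : 0 < β := by linarith
    set s := √(-β * deriv (deriv (hlog f)) 0) with hs
    have hs2 : s ^ 2 = β * a := by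
      rw [hs, Real.sq_sqrt (hpos β h1).le, ha]; ring
    have hs1 : 1 ≤ s := by
      rw [div_le_iff₀ ha0] at hβa
      rw [hs, Real.one_le_sqrt]
      linarith
    have hs0 : 0 < s := by linarith
    have hi8 := integrable_pow_eight_mul_exp hβ₀ (by positivity)
      (fun x => (hsm.differentiable (by norm_num)).differentiableAt.hasDerivAt) hgrow
      (fun β hβ => by simpa only [rpow_eq_exp_hlog hf] using hint β hβ) hi4 h9
    have main := abs_quanta_add_le hf hsm hmode hM hb hβ hs0 hs (hint β h1) hi8 (hmom8 β h1)
      (by positivity : 0 ≤ D / s ^ p) (fun x => hP s x hs1)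
    have hsp : s ^ p = β ^ (p / 2 : ℝ) * a ^ (p / 2 : ℝ) := by
      rw [← Real.mul_rpow hβ.le ha0.le, ← hs2, ← Real.rpow_natCast s 2, ← Real.rpow_mul hs0.le,
        ← Real.rpow_natCast]
      congr 1
      push_cast; ring
    have hsq : (D / s ^ p) ^ 2 ≤ D ^ 2 / (s ^ p * (β * a)) := by
      rw [div_pow, sq (s ^ p), ← hs2]
      gcongr
      omega
    have hpow : β ^ (-((p + 2) / 2 : ℝ)) = (β ^ (p / 2 : ℝ) * β)⁻¹ := by
      rw [Real.rpow_neg hβ.le, add_div, Real.rpow_add hβ]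
      norm_num
    rw [hpow, Real.norm_eq_abs, Real.norm_of_nonneg (by positivity)]
    refine main.trans ?_
    calc _ ≤ 4 * (1 / (2 * β) * (D / s ^ p) + D ^ 2 / (s ^ p * (β * a))) * K ^ 2
          + D / s ^ p * K / (4 * β) := by gcongr
      _ = _ := by rw [hsp]; field_simp; ring
  have hmain : (fun β => (Vargb f β (fun y => y ^ 2) - 2) / (4 * β ^ 2))
      =O[atTop] fun β : ℝ => β ^ (-(2 + γ)) := by
    have h2 : (fun β : ℝ => (4 * β ^ 2)⁻¹) =O[atTop] fun β : ℝ => β ^ (-2 : ℝ) := by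
      refine IsBigO.of_bound (1 / 4) ?_
      filter_upwards [eventually_gt_atTop 0] with β hβ
      rw [Real.rpow_neg hβ.le, Real.rpow_two, Real.norm_of_nonneg (by positivity),
        Real.norm_of_nonneg (by positivity), mul_inv]
      norm_num
    refine (hvar.mul h2).congr' (by simp only [div_eq_mul_inv]; rfl) ?_
    filter_upwards [eventually_gt_atTop 0] with β hβ
    rw [← Real.rpow_add hβ]
    congr 1
    ring
  have mono : ∀ {k l : ℝ}, l ≤ k → (fun β : ℝ => β ^ (-k)) =O[atTop] fun β : ℝ => β ^ (-l) := by
    intro k l hkl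
    refine IsBigO.of_bound 1 ?_
    filter_upwards [eventually_ge_atTop 1] with β hβ
    rw [Real.norm_of_nonneg (by positivity), Real.norm_of_nonneg (by positivity), one_mul]
    exact Real.rpow_le_rpow_of_exponent_le hβ (by linarith)
  refine ((hrem.trans (mono (min_le_right _ _))).sub
    (hmain.trans (mono (min_le_left _ _)))).congr_left fun β => ?_
  ring

/-- Cold Temperature Scalings: with `I(β) = Var_β[log f]` and
`R(β) = E_β[X²h''(X) − Xh'(X)]`, one has
`1/(2β²) − I(β) + R(β)/(4β) = O(β^{−k})` as `β → ∞`, where `k = min(2+γ, 3) > 2` if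
`h'''(0) = 0`, and `k = min(2+γ, 5/2) > 2` otherwise. -/
theorem cold_temperature_scalings
    (f : ℝ → ℝ) (hf_pos : ∀ x, 0 < f x)
    (hsmooth : ContDiff ℝ 4 (hlog f))
    (hmode : deriv (hlog f) 0 = 0)
    (hcurv : deriv (deriv (hlog f)) 0 < 0)
    (M : ℝ) (hM : 0 < M)
    (hbound : ∀ z, |deriv (deriv (deriv (deriv (hlog f)))) z| ≤ M)
    (hint : ∀ β : ℝ, 1 ≤ β → Integrable (fun x => f x ^ β))
    (C : ℝ) (hmom8 : ∀ β : ℝ, 1 ≤ β → Egb f β (fun y => y ^ 8) ≤ C)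
    (γ : ℝ) (hγ : 0 < γ)
    (hvar : (fun β => Vargb f β (fun y => y ^ 2) - 2) =O[atTop] fun β : ℝ => β ^ (-γ)) :
    (2 < min (2 + γ) (5 / 2) ∧
      (fun β => 1 / (2 * β ^ 2) - Varb f β (hlog f)
          + Eb f β (fun x => x ^ 2 * deriv (deriv (hlog f)) x - x * deriv (hlog f) x)
            / (4 * β))
        =O[atTop] fun β : ℝ => β ^ (-(min (2 + γ) (5 / 2)))) ∧
    (deriv (deriv (deriv (hlog f))) 0 = 0 →
      2 < min (2 + γ) 3 ∧
      (fun β => 1 / (2 * β ^ 2) - Varb f β (hlog f)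
          + Eb f β (fun x => x ^ 2 * deriv (deriv (hlog f)) x - x * deriv (hlog f) x)
            / (4 * β))
        =O[atTop] fun β : ℝ => β ^ (-(min (2 + γ) 3))) := by
  have hw : ∀ t : ℝ, |t| ^ 3 ≤ 1 + t ^ 4 := fun t => by
    rw [← Even.pow_abs (by decide) t]
    have := abs_nonneg t
    rcases le_total |t| 1 with h | h
    · nlinarith [pow_le_one₀ (n := 3) this h, pow_nonneg this 4]
    · nlinarith [pow_nonneg this 3]
  have hw4 : ∀ s x : ℝ, 1 ≤ s → |x| ^ 4 ≤ 1 / s ^ 4 * (1 + (s * x) ^ 4) := fun s x hs => by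
    have : 0 < s := by linarith
    rw [Even.pow_abs (by decide), one_div_mul_eq_div, le_div_iff₀ (by positivity)]
    linarith [mul_pow s x 4]
  have hw3 : ∀ s x : ℝ, 1 ≤ s → |x| ^ 3 ≤ 1 / s ^ 3 * (1 + (s * x) ^ 4) := fun s x hs => by
    have h0 : 0 < s := by linarith
    rw [one_div_mul_eq_div, le_div_iff₀ (by positivity)]
    have := hw (s * x)
    rw [abs_mul, mul_pow, abs_of_pos h0] at this
    linarith
  have hb0 := abs_nonneg (deriv (deriv (deriv (hlog f))) 0)
  refine ⟨⟨by rw [lt_min_iff]; constructor <;> linarith, ?_⟩, fun h3 =>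
    ⟨by rw [lt_min_iff]; constructor <;> linarith, ?_⟩⟩
  · have := quanta_isBigO_of_remainder hf_pos hsmooth hmode hcurv hM.le hbound hint hmom8 hγ hvar
      (le_refl 3) (D := |deriv (deriv (deriv (hlog f))) 0| + 2 * M) (by positivity) ?_
    · norm_num at this ⊢
      exact this
    · intro s x hs
      have h4 : |x| ^ 4 ≤ 1 / s ^ 3 * (1 + (s * x) ^ 4) := by
        refine (hw4 s x hs).trans ?_
        gcongr
        norm_num
      calc _ ≤ |deriv (deriv (deriv (hlog f))) 0| * (1 / s ^ 3 * (1 + (s * x) ^ 4))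
            + 2 * M * (1 / s ^ 3 * (1 + (s * x) ^ 4)) := by
              gcongr
              exact hw3 s x hs
        _ = _ := by ring
  · have := quanta_isBigO_of_remainder hf_pos hsmooth hmode hcurv hM.le hbound hint hmom8 hγ hvar
      (p := 4) (by norm_num) (D := 2 * M) (by positivity) ?_
    · norm_num at this ⊢
      exact this
    · intro s x hs
      rw [h3, abs_zero, zero_mul, zero_add]
      calc _ ≤ 2 * M * (1 / s ^ 4 * (1 + (s * x) ^ 4)) := by
              gcongr
              exact hw4 s x hs
        _ = _ := by ring
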